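/- arXiv:2209.13867 — 2 statements merged into one kernel-verified Lean document; each statement's English description precedes it below -/
import Mathlib

section
/- Let q ≥ 8 be an integer satisfying q ≡ 0 or 1 (mod 4), and let ℓ = C(q,2) = q(q−1)/2. For every integer k ≥ 1 and n = (ℓ+2)^k, there exists a completely balanced edge-coloring of the complete graph K_n with ℓ+1 colors that contains no rainbow copy of K_q. -/
/-- A set `S` of vertices is rainbow under an edge-coloring `c` if all edges with both
endpoints in `S` receive pairwise distinct colors. -/
def IsRainbow {V C : Type*} (c : V → V → C) (S : Finset V) : Prop :=
  ∀ a ∈ S, ∀ b ∈ S, ∀ a' ∈ S, ∀ b' ∈ S,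
    a ≠ b → a' ≠ b' → c a b = c a' b' → (a = a' ∧ b = b') ∨ (a = b' ∧ b = a')

/-- The coloring `c` contains a rainbow copy of `K_q`. -/
def HasRainbowClique {V C : Type*} (c : V → V → C) (q : ℕ) : Prop :=
  ∃ S : Finset V, S.card = q ∧ IsRainbow c S

/-- An edge-coloring of `K_n` with `l` colors is completely balanced if every vertex
is incident to exactly `(n-1)/l` edges of each color; in particular `l` divides `n-1`. -/
def IsCompletelyBalanced {n l : ℕ} (c : Fin n → Fin n → Fin l) : Prop :=
  ∃ d : ℕ, n - 1 = l * d ∧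
    ∀ v : Fin n, ∀ k : Fin l,
      (Finset.univ.filter fun u => u ≠ v ∧ c v u = k).card = d

section Coloring

variable {V W C D : Type*}

/-- Every vertex is incident to exactly `d` edges of each color. -/
def HasColorDegree [Fintype V] [DecidableEq V] [DecidableEq C] (c : V → V → C) (d : ℕ) : Prop :=
  ∀ v k, (Finset.univ.filter fun u => u ≠ v ∧ c v u = k).card = d

/-- The lexicographic product of two edge-colorings: edges inside a fiber of the first projection
are colored by the second coloring, all others by the first one. -/
def lexColoring [DecidableEq V] (c : V → V → C) (f : W → W → C) (x y : V × W) : C :=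
  if x.1 = y.1 then f x.2 y.2 else c x.1 y.1

lemma IsRainbow.comp_image [DecidableEq W] {c : W → W → C} {f : V → W} {g : C → D}
    {c' : V → V → D} {S : Finset V} (hS : IsRainbow c' S)
    (h : ∀ a ∈ S, ∀ b ∈ S, a ≠ b → c' a b = g (c (f a) (f b))) :
    IsRainbow c (S.image f) := by
  simp only [IsRainbow, Finset.forall_mem_image]
  intro a ha b hb a' ha' b' hb' hab hab' hc
  have hne : a ≠ b := fun e => hab (e ▸ rfl)
  have hne' : a' ≠ b' := fun e => hab' (e ▸ rfl)
  rcases hS a ha b hb a' ha' b' hb' hne hne'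
    (by rw [h a ha b hb hne, h a' ha' b' hb' hne', hc]) with ⟨rfl, rfl⟩ | ⟨rfl, rfl⟩ <;> simp

lemma HasRainbowClique.of_comp {c : W → W → C} {f : V → W} {g : C → D} {q : ℕ}
    (hf : Function.Injective f)
    (h : HasRainbowClique (fun a b => g (c (f a) (f b))) q) : HasRainbowClique c q := by
  classical
  obtain ⟨S, hq, hS⟩ := h
  exact ⟨S.image f, by rw [Finset.card_image_of_injective _ hf, hq],
    hS.comp_image fun _ _ _ _ _ => rfl⟩

lemma HasColorDegree.comp_equiv [Fintype V] [DecidableEq V] [Fintype W] [DecidableEq W]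
    [DecidableEq C] [DecidableEq D] {c : W → W → C} {d : ℕ} (h : HasColorDegree c d)
    (f : V ≃ W) (g : C ≃ D) : HasColorDegree (fun a b => g (c (f a) (f b))) d := by
  intro v k
  rw [← h (f v) (g.symm k)]
  refine Finset.card_equiv f fun u => ?_
  simp [Equiv.eq_symm_apply]

lemma lexColoring_comm [DecidableEq V] {c : V → V → C} {f : W → W → C}
    (hc : ∀ a b, c a b = c b a) (hf : ∀ a b, f a b = f b a) (x y : V × W) :
    lexColoring c f x y = lexColoring c f y x := by
  simp only [lexColoring, hc x.1, hf x.2, eq_comm (a := x.1)]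

lemma HasColorDegree.lexColoring [Fintype V] [DecidableEq V] [Fintype W] [DecidableEq W]
    [DecidableEq C] {c : V → V → C} {f : W → W → C} {d e : ℕ} (hc : HasColorDegree c d)
    (hf : HasColorDegree f e) :
    HasColorDegree (lexColoring c f) (d * Fintype.card W + e) := by
  intro v k
  have hsplit : (Finset.univ.filter fun u => u ≠ v ∧ _root_.lexColoring c f v u = k) =
      (Finset.univ.filter fun u => u ≠ v.1 ∧ c v.1 u = k) ×ˢ Finset.univ ∪
        {v.1} ×ˢ (Finset.univ.filter fun u => u ≠ v.2 ∧ f v.2 u = k) := by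
    ext ⟨a, b⟩
    obtain ⟨x, y⟩ := v
    by_cases h : x = a
    · subst h
      simp [_root_.lexColoring]
    · simp [_root_.lexColoring, h, Ne.symm h]
  rw [hsplit, Finset.card_union_of_disjoint, Finset.card_product, Finset.card_product, hc, hf]
  · simp
  · rw [Finset.disjoint_left]
    rintro ⟨a, b⟩
    simp +contextual [eq_comm]

lemma HasRainbowClique.of_lexColoring [DecidableEq V] {c : V → V → C} {f : W → W → C} {q : ℕ}
    (h : HasRainbowClique (lexColoring c f) q) :
    HasRainbowClique c q ∨ HasRainbowClique f q := by
  classical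
  obtain ⟨S, hq, hS⟩ := h
  by_cases hinj : Set.InjOn Prod.fst (S : Set (V × W))
  · refine Or.inl ⟨S.image Prod.fst, by rw [Finset.card_image_of_injOn hinj, hq],
      hS.comp_image (g := id) fun a ha b hb hab => ?_⟩
    rw [lexColoring, if_neg fun e => hab (hinj ha hb e), id]
  · simp only [Set.InjOn, not_forall] at hinj
    obtain ⟨x, hx, y, hy, hxy, hne⟩ := hinj
    have hfst : ∀ z ∈ S, x.1 = z.1 := by
      intro z hz
      by_contra hxz
      have hc : lexColoring c f x z = lexColoring c f y z := by
        simp only [lexColoring, if_neg hxz, ← hxy]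
      rcases hS x hx z hz y hy z hz (fun e => hxz (e ▸ rfl))
        (fun e => hxz (e ▸ hxy)) hc with ⟨e, -⟩ | ⟨e, -⟩
      · exact hne e
      · exact hxz (e ▸ rfl)
    have hsnd : Set.InjOn Prod.snd (S : Set (V × W)) := fun a ha b hb e =>
      Prod.ext ((hfst a ha).symm.trans (hfst b hb)) e
    refine Or.inr ⟨S.image Prod.snd, by rw [Finset.card_image_of_injOn hsnd, hq],
      hS.comp_image (g := id) fun a ha b hb _ => ?_⟩
    rw [lexColoring, if_pos ((hfst a ha).symm.trans (hfst b hb)), id]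

/-- Iterated lexicographic powers of a proper edge-coloring in which every color class is a
perfect matching. -/
lemma exists_lexPower [Fintype C] [DecidableEq C] {W : Type} [Fintype W] [DecidableEq W]
    {f : W → W → C} {q : ℕ} (hW : Fintype.card W = Fintype.card C + 1)
    (hf : ∀ a b, f a b = f b a) (hdeg : HasColorDegree f 1) (hq : 2 ≤ q)
    (hrain : ¬ HasRainbowClique f q) (k : ℕ) :
    ∃ (V : Type) (_ : Fintype V) (_ : DecidableEq V) (c : V → V → C) (d : ℕ),
      Fintype.card V = Fintype.card W ^ k ∧ Fintype.card V = Fintype.card C * d + 1 ∧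
      (∀ a b, c a b = c b a) ∧ HasColorDegree c d ∧ ¬ HasRainbowClique c q := by
  induction k with
  | zero =>
    have hne : Nonempty W := Fintype.card_pos_iff.mp (by omega)
    obtain ⟨w⟩ := hne
    refine ⟨Unit, inferInstance, inferInstance, fun _ _ => f w w, 0, by simp, by simp,
      fun _ _ => rfl, fun v k => by simp, ?_⟩
    rintro ⟨S, hS, -⟩
    have := S.card_le_univ
    simp only [Fintype.card_unit] at this
    omega
  | succ k ih =>
    obtain ⟨V, _, _, c, d, hcard, hd, hc, hcdeg, hcrain⟩ := ih
    refine ⟨V × W, inferInstance, inferInstance, lexColoring c f, d * Fintype.card W + 1,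
      by rw [Fintype.card_prod, hcard, pow_succ], ?_, lexColoring_comm hc hf,
      hcdeg.lexColoring hdeg, fun h => h.of_lexColoring.elim hcrain hrain⟩
    rw [Fintype.card_prod, hd, hW]
    ring

end Coloring

section SumColoring

variable {G : Type*} [AddCommGroup G]

/-- The standard edge-coloring of the complete graph on `G ∪ {∞}`: the edge `{x, y}` has color
`x + y`, and the edge `{∞, x}` has color `x + x`. -/
def sumColoring : Option G → Option G → G
  | some x, some y => x + y
  | none, some x => x + x
  | some x, none => x + x
  | none, none => 0

lemma sumColoring_comm (a b : Option G) : sumColoring a b = sumColoring b a := by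
  cases a <;> cases b <;> simp [sumColoring, add_comm]

lemma hasColorDegree_sumColoring [Fintype G] [DecidableEq G]
    (hG : Function.Bijective fun x : G => x + x) :
    HasColorDegree (sumColoring (G := G)) 1 := by
  intro v k
  rw [Finset.card_eq_one]
  cases v with
  | none =>
    obtain ⟨x, rfl⟩ := hG.2 k
    refine ⟨some x, Finset.ext fun u => ?_⟩
    rw [Finset.mem_filter]
    cases u with
    | none => simp
    | some y => simpa [sumColoring] using hG.1.eq_iff (a := y) (b := x)
  | some x =>
    by_cases hk : x + x = k
    · refine ⟨none, Finset.ext fun u => ?_⟩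
      rw [Finset.mem_filter]
      cases u with
      | none => simpa [sumColoring] using hk
      | some y => simp [sumColoring, ← hk]
    · refine ⟨some (k - x), Finset.ext fun u => ?_⟩
      rw [Finset.mem_filter]
      cases u with
      | none => simpa [sumColoring] using hk
      | some y =>
        simp only [Finset.mem_univ, true_and, sumColoring, ne_eq,
          Option.some_inj, Finset.mem_singleton]
        constructor
        · rintro ⟨-, rfl⟩
          abel
        · rintro rfl
          refine ⟨fun e => hk ?_, by abel⟩
          nth_rewrite 1 [← e]
          abel

/-- A set all of whose sums of two distinct elements are distinct has few elements. -/
lemma card_mul_le_of_isRainbow_add [Fintype G]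
    (hG : Function.Injective fun x : G => x + x) {A : Finset G}
    (hA : IsRainbow (fun x y : G => x + y) A) :
    A.card * (A.card - 1) ≤ Fintype.card G - 1 + 2 * A.card := by
  classical
  set bad := A.offDiag.filter fun p => p.1 + p.1 - p.2 ∈ A
  set good := A.offDiag.filter fun p => ¬ p.1 + p.1 - p.2 ∈ A
  have hsum : bad.card + good.card = A.offDiag.card :=
    Finset.card_filter_add_card_filter_not _
  have hbad : bad.card ≤ 2 * A.card := by
    refine Finset.card_le_mul_card_image_of_maps_to (f := Prod.fst) (t := A)
      (fun p hp => (Finset.mem_offDiag.mp (Finset.mem_filter.mp hp).1).1) 2 fun a _ => ?_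
    rcases Finset.eq_empty_or_nonempty (bad.filter fun p => p.1 = a) with h | ⟨⟨a', b⟩, hb⟩
    · exact (Finset.card_eq_zero.mpr h).trans_le (Nat.zero_le _)
    · refine (Finset.card_le_card (t := {(a, b), (a, a + a - b)}) ?_).trans Finset.card_le_two
      rintro ⟨a'', b'⟩ hb'
      simp only [bad, Finset.mem_filter, Finset.mem_offDiag] at hb hb'
      obtain ⟨⟨⟨-, hb, hab⟩, hbA⟩, rfl⟩ := hb
      obtain ⟨⟨⟨-, hb', hab'⟩, hbA'⟩, rfl⟩ := hb'
      have hne : ∀ {x y : G}, x ≠ y → y ≠ x + x - y := fun h e =>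
        h (hG (eq_sub_iff_add_eq.mp e)).symm
      rcases hA _ hb' _ hbA' _ hb _ hbA (hne hab') (hne hab) (by simp) with ⟨h, -⟩ | ⟨h, -⟩ <;>
        simp [h]
  have hgood : good.card ≤ (Finset.univ.erase (0 : G)).card := by
    refine Finset.card_le_card_of_injOn (fun p => p.1 - p.2) ?_ ?_
    · rintro ⟨a, b⟩ h
      simp only [good, Finset.coe_filter, Set.mem_ofPred_eq, Finset.mem_offDiag] at h
      simpa [sub_eq_zero] using h.1.2.2
    · rintro ⟨a, b⟩ h ⟨c, d⟩ h' e
      simp only [good, Finset.coe_filter, Set.mem_ofPred_eq, Finset.mem_offDiag] at h h'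
      obtain ⟨⟨ha, hb, hab⟩, habA⟩ := h
      obtain ⟨⟨hc, hd, hcd⟩, hcdA⟩ := h'
      have e' : a + d = c + b := sub_eq_sub_iff_add_eq_add.mp e
      by_cases had : a = d
      · subst had
        exact absurd (by rwa [e', add_sub_cancel_right]) habA
      by_cases hcb : c = b
      · subst hcb
        exact absurd (by rwa [← e', add_sub_cancel_right]) hcdA
      rcases hA a ha d hd c hc b hb had hcb e' with ⟨rfl, rfl⟩ | ⟨rfl, -⟩
      · rfl
      · exact absurd rfl hab
  rw [Finset.card_erase_of_mem (Finset.mem_univ _), Finset.card_univ] at hgood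
  rw [Finset.offDiag_card, ← Nat.mul_sub_one] at hsum
  omega

/-- A set all of whose sums of two elements are distinct has few elements. -/
lemma card_mul_le_of_sidon [Fintype G] {A : Finset G}
    (hA : ∀ a ∈ A, ∀ b ∈ A, ∀ c ∈ A, ∀ d ∈ A, a + d = c + b → a = c ∨ a = b) :
    A.card * (A.card - 1) ≤ Fintype.card G - 1 := by
  classical
  have h : A.offDiag.card ≤ (Finset.univ.erase (0 : G)).card := by
    refine Finset.card_le_card_of_injOn (fun p => p.1 - p.2) ?_ ?_
    · rintro ⟨a, b⟩ h
      simp only [Finset.coe_offDiag, Set.mem_offDiag] at h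
      simpa [sub_eq_zero] using h.2.2
    · rintro ⟨a, b⟩ h ⟨c, d⟩ h' e
      simp only [Finset.coe_offDiag, Set.mem_offDiag, Finset.mem_coe] at h h'
      have e' : a + d = c + b := sub_eq_sub_iff_add_eq_add.mp e
      rcases hA a h.1 b h.2.1 c h'.1 d h'.2.1 e' with rfl | rfl
      · rw [add_left_cancel e']
      · exact absurd rfl h.2.2
  rwa [Finset.offDiag_card, Finset.card_erase_of_mem (Finset.mem_univ _), Finset.card_univ,
    ← Nat.mul_sub_one] at h

lemma not_hasRainbowClique_sumColoring [Fintype G]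
    (hG : Function.Injective fun x : G => x + x) {q : ℕ} (hq : 6 ≤ q)
    (hcard : 2 * (Fintype.card G - 1) = q * (q - 1)) :
    ¬ HasRainbowClique (sumColoring (G := G)) q := by
  classical
  rintro ⟨S, hSq, hS⟩
  obtain ⟨m, rfl⟩ : ∃ m, q = m + 1 := ⟨q - 1, by omega⟩
  simp only [Nat.add_sub_cancel] at hcard
  set A := Finset.eraseNone S with hAdef
  have hmem : ∀ {x}, x ∈ A ↔ some x ∈ S := Finset.mem_eraseNone
  by_cases hnone : none ∈ S
  · have hAcard : A.card = m := by
      rw [hAdef, Finset.card_eraseNone_of_mem hnone, hSq, Nat.add_sub_cancel]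
    have := card_mul_le_of_sidon (A := A) ?_
    · rw [hAcard] at this
      obtain ⟨j, rfl⟩ : ∃ j, m = j + 1 := ⟨m - 1, by omega⟩
      simp only [Nat.add_sub_cancel] at this
      nlinarith
    · intro a ha b hb c hc d hd e
      rw [hmem] at ha hb hc hd
      by_cases had : a = d
      · subst had
        by_cases hcb : c = b
        · subst hcb
          exact Or.inl (hG e)
        · simpa using hS none hnone _ ha _ hc _ hb (by simp) (by simpa using hcb) e
      · by_cases hcb : c = b
        · subst hcb
          simpa using hS _ ha _ hd none hnone _ hc (by simpa using had) (by simp) e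
        · have := hS _ ha _ hd _ hc _ hb (by simpa using had) (by simpa using hcb) e
          simp only [Option.some_inj] at this
          tauto
  · have hAcard : A.card = m + 1 := by
      rw [hAdef, Finset.card_eraseNone_of_not_mem hnone, hSq]
    have := card_mul_le_of_isRainbow_add hG (A := A) ?_
    · rw [hAcard] at this
      simp only [Nat.add_sub_cancel] at this
      nlinarith
    · intro a ha b hb c hc d hd hab hcd e
      simpa using hS _ (hmem.mp ha) _ (hmem.mp hb) _ (hmem.mp hc) _ (hmem.mp hd)
        (by simpa using hab) (by simpa using hcd) e

end SumColoring

lemma ZMod.add_self_bijective {n : ℕ} [NeZero n] (hn : Odd n) :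
    Function.Bijective fun x : ZMod n => x + x := by
  have h : IsUnit (2 : ZMod n) := by
    simpa using (ZMod.isUnit_iff_coprime 2 n).mpr (Nat.coprime_two_left.mpr hn)
  simpa only [two_mul] using IsUnit.isUnit_iff_mulLeft_bijective.mp h

theorem no_rainbow_clique_balanced_coloring_more_colors
    (q : ℕ) (hq : 8 ≤ q) (hmod : q % 4 = 0 ∨ q % 4 = 1)
    (k : ℕ) (hk : 1 ≤ k) :
    ∃ c : Fin ((q * (q - 1) / 2 + 2) ^ k) → Fin ((q * (q - 1) / 2 + 2) ^ k) →
        Fin (q * (q - 1) / 2 + 1),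
      (∀ a b, c a b = c b a) ∧ IsCompletelyBalanced c ∧ ¬ HasRainbowClique c q := by
  have hℓ : 2 * (q * (q - 1) / 2) = q * (q - 1) :=
    Nat.mul_div_cancel' (Nat.even_mul_pred_self q).two_dvd
  have hodd : Odd (q * (q - 1) / 2 + 1) := by
    have h4 : 4 ∣ q * (q - 1) := by
      rcases hmod with h | h
      · exact (Nat.dvd_of_mod_eq_zero h).mul_right _
      · exact (show 4 ∣ q - 1 by omega).mul_left _
    exact Even.add_one (even_iff_two_dvd.mpr (by omega))
  generalize q * (q - 1) / 2 = ℓ at *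
  have hbij := ZMod.add_self_bijective hodd
  obtain ⟨V, _, _, c, d, hcard, hd, hc, hdeg, hrain⟩ :=
    exists_lexPower (f := sumColoring (G := ZMod (ℓ + 1))) (by simp) sumColoring_comm
      (hasColorDegree_sumColoring hbij) (by omega : 2 ≤ q)
      (not_hasRainbowClique_sumColoring hbij.1 (by omega) (by simpa using hℓ)) k
  simp only [Fintype.card_option, ZMod.card] at hcard hd
  let e : Fin ((ℓ + 2) ^ k) ≃ V := (Fintype.equivFinOfCardEq hcard).symm
  let g : ZMod (ℓ + 1) ≃ Fin (ℓ + 1) := Fintype.equivFinOfCardEq (ZMod.card _)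
  exact ⟨fun a b => g (c (e a) (e b)), fun a b => congrArg g (hc _ _),
    ⟨d, by rw [show (ℓ + 2) ^ k = (ℓ + 1) * d + 1 from hcard.symm.trans hd, Nat.add_sub_cancel],
      hdeg.comp_equiv e g⟩, fun h => hrain (h.of_comp e.injective)⟩
end

section
/- Let q ≥ 2 be an integer. If there is no perfect difference set of size q in Z_{q²−q+1}, then for every integer n₀ there exists an integer n ≥ n₀ with n ≡ 1 (mod C(q,2)) such that the complete graph K_n admits a completely balanced edge-coloring with C(q,2) colors containing no rainbow copy of K_q. -/
/-- `A ⊆ ZMod n` is a perfect difference set if every nonzero element of `ZMod n` can be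
written uniquely as a difference of two elements of `A`. -/
def IsPerfectDifferenceSet {n : ℕ} (A : Finset (ZMod n)) : Prop :=
  ∀ x : ZMod n, x ≠ 0 →
    ∃! p : ZMod n × ZMod n, p.1 ∈ A ∧ p.2 ∈ A ∧ p.1 - p.2 = x

/-- The image of a rainbow set under a map that preserves colors is rainbow. -/
theorem IsRainbow.image {V W C : Type*} [DecidableEq W] {c : V → V → C} {c' : W → W → C}
    {S : Finset V} (hS : IsRainbow c S) {f : V → W}
    (hc : ∀ a ∈ S, ∀ b ∈ S, a ≠ b → c' (f a) (f b) = c a b) : IsRainbow c' (S.image f) := by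
  intro a ha b hb a' ha' b' hb' hab hab' h
  simp only [Finset.mem_image] at ha hb ha' hb'
  obtain ⟨a, ha, rfl⟩ := ha
  obtain ⟨b, hb, rfl⟩ := hb
  obtain ⟨a', ha', rfl⟩ := ha'
  obtain ⟨b', hb', rfl⟩ := hb'
  have hne : a ≠ b := fun e => hab (congrArg f e)
  have hne' : a' ≠ b' := fun e => hab' (congrArg f e)
  rw [hc a ha b hb hne, hc a' ha' b' hb' hne'] at h
  rcases hS a ha b hb a' ha' b' hb' hne hne' h with ⟨rfl, rfl⟩ | ⟨rfl, rfl⟩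
  · exact Or.inl ⟨rfl, rfl⟩
  · exact Or.inr ⟨rfl, rfl⟩

/-- `V` carries a symmetric coloring with `l` colors in which every vertex meets equally many
edges of each color, and which has no rainbow clique of size `q`. -/
def HasBalancedColoring (V : Type*) [Fintype V] [DecidableEq V] (l q : ℕ) : Prop :=
  ∃ c : V → V → Fin l, (∀ a b, c a b = c b a) ∧
    (∃ d : ℕ, Fintype.card V = l * d + 1 ∧
      ∀ v : V, ∀ k : Fin l, (Finset.univ.filter fun u => u ≠ v ∧ c v u = k).card = d) ∧
    ¬ HasRainbowClique c q

theorem HasBalancedColoring.of_equiv {V W : Type*} [Fintype V] [DecidableEq V] [Fintype W]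
    [DecidableEq W] {l q : ℕ} (e : V ≃ W) (h : HasBalancedColoring V l q) :
    HasBalancedColoring W l q := by
  obtain ⟨c, hsymm, ⟨d, hcard, hd⟩, hr⟩ := h
  refine ⟨fun a b => c (e.symm a) (e.symm b), fun a b => hsymm _ _,
    ⟨d, by rw [← Fintype.card_congr e, hcard], fun v k => ?_⟩, ?_⟩
  · rw [← hd (e.symm v) k]
    refine Finset.card_equiv e.symm fun u => ?_
    simp
  · rintro ⟨S, hS, hrain⟩
    exact hr ⟨S.image e.symm, by rw [Finset.card_image_of_injective _ e.symm.injective, hS],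
      hrain.image fun _ _ _ _ _ => rfl⟩

/-- Balanced colorings without rainbow cliques are closed under lexicographic products. -/
theorem HasBalancedColoring.prod {V W : Type*} [Fintype V] [DecidableEq V] [Fintype W]
    [DecidableEq W] {l q : ℕ} (hV : HasBalancedColoring V l q) (hW : HasBalancedColoring W l q) :
    HasBalancedColoring (V × W) l q := by
  obtain ⟨c₁, hsymm₁, ⟨d₁, hcard₁, hd₁⟩, hr₁⟩ := hV
  obtain ⟨c₂, hsymm₂, ⟨d₂, hcard₂, hd₂⟩, hr₂⟩ := hW
  set c : V × W → V × W → Fin l :=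
    fun a b => if a.1 = b.1 then c₂ a.2 b.2 else c₁ a.1 b.1 with hc
  refine ⟨c, fun a b => ?_, ⟨d₁ * Fintype.card W + d₂, ?_, fun v k => ?_⟩, ?_⟩
  · simp only [hc, hsymm₁ a.1, hsymm₂ a.2, eq_comm (a := a.1)]
  · rw [Fintype.card_prod, hcard₁, hcard₂]
    ring
  · have hsplit : (Finset.univ.filter fun u => u ≠ v ∧ c v u = k) =
        (Finset.univ.filter fun x => x ≠ v.1 ∧ c₁ v.1 x = k) ×ˢ Finset.univ ∪
          {v.1} ×ˢ (Finset.univ.filter fun y => y ≠ v.2 ∧ c₂ v.2 y = k) := by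
      ext ⟨x, y⟩
      obtain ⟨x', y'⟩ := v
      by_cases hx : x = x'
      · subst hx
        simp [hc]
      · simp [hc, hx, Ne.symm hx]
    rw [hsplit, Finset.card_union_of_disjoint, Finset.card_product, Finset.card_product, hd₁, hd₂,
      Finset.card_univ, Finset.card_singleton, one_mul]
    rw [Finset.disjoint_left]
    rintro ⟨x, y⟩ h₁ h₂
    simp only [Finset.mem_product, Finset.mem_filter, Finset.mem_singleton] at h₁ h₂
    exact h₁.1.2.1 h₂.1
  · rintro ⟨S, hS, hrain⟩
    by_cases hinj : Set.InjOn Prod.fst (S : Set (V × W))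
    · refine hr₁ ⟨S.image Prod.fst, by rw [Finset.card_image_of_injOn hinj, hS],
        hrain.image fun a ha b hb hab => ?_⟩
      have hne : a.1 ≠ b.1 := fun e => hab (hinj ha hb e)
      simp [hc, hne]
    · simp only [Set.InjOn, not_forall] at hinj
      obtain ⟨a, ha, b, hb, hab, hne⟩ := hinj
      have hfib : ∀ w ∈ S, w.1 = a.1 := by
        intro w hw
        by_contra hwa
        have hwb : w.1 ≠ b.1 := fun e => hwa (e.trans hab.symm)
        have hwa' : w ≠ a := fun e => hwa (congrArg _ e)
        have hwb' : w ≠ b := fun e => hwb (congrArg _ e)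
        rcases hrain w hw a ha w hw b hb hwa' hwb' (by simp [hc, hwb, hab]) with h | h
        · exact hne h.2
        · exact hwb' h.1
      have hinj₂ : Set.InjOn Prod.snd (S : Set (V × W)) := fun x hx y hy hxy =>
        Prod.ext ((hfib x hx).trans (hfib y hy).symm) hxy
      refine hr₂ ⟨S.image Prod.snd, by rw [Finset.card_image_of_injOn hinj₂, hS],
        hrain.image fun x hx y hy _ => ?_⟩
      simp [hc, hfib x hx, hfib y hy]

theorem HasBalancedColoring.pow {V : Type*} [Fintype V] [DecidableEq V] {l q : ℕ}
    (h : HasBalancedColoring V l q) (k : ℕ) :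
    HasBalancedColoring (Fin (Fintype.card V ^ (k + 1))) l q := by
  induction k with
  | zero => exact h.of_equiv (Fintype.equivFinOfCardEq (by simp))
  | succ k ih => exact (ih.prod h).of_equiv (Fintype.equivFinOfCardEq (by simp [pow_succ]))

theorem ZMod.eq_zero_of_eq_neg_self {l : ℕ} {x : ZMod (2 * l + 1)} (h : x = -x) : x = 0 := by
  rcases ZMod.neg_eq_self_iff x |>.1 h.symm with h | h
  · exact h
  · omega

/-- A set of `q` residues modulo `q * q - q + 1` whose nonzero differences are pairwise distinct
is a perfect difference set. -/
theorem isPerfectDifferenceSet_of_injOn {n : ℕ} [NeZero n] {A : Finset (ZMod n)}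
    (hn : n = A.card * A.card - A.card + 1)
    (h : Set.InjOn (fun p : ZMod n × ZMod n => p.1 - p.2) A.offDiag) :
    IsPerfectDifferenceSet A := by
  have himage : A.offDiag.image (fun p => p.1 - p.2) = Finset.univ.erase 0 := by
    refine Finset.eq_of_subset_of_card_le ?_ ?_
    · intro x hx
      obtain ⟨p, hp, rfl⟩ := Finset.mem_image.1 hx
      simpa [sub_eq_zero] using (Finset.mem_offDiag.1 hp).2.2
    · rw [Finset.card_image_of_injOn h, Finset.offDiag_card,
        Finset.card_erase_of_mem (Finset.mem_univ _), Finset.card_univ, ZMod.card]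
      omega
  intro x hx
  have hmem : x ∈ A.offDiag.image (fun p => p.1 - p.2) := by simp [himage, hx]
  obtain ⟨p, hp, rfl⟩ := Finset.mem_image.1 hmem
  have hp' := Finset.mem_offDiag.1 hp
  refine ⟨p, ⟨hp'.1, hp'.2.1, rfl⟩, fun r hr => h ?_ hp hr.2.2⟩
  refine Finset.mem_coe.2 (Finset.mem_offDiag.2 ⟨hr.1, hr.2.1, fun e => hx ?_⟩)
  rw [← hr.2.2, e, sub_self]

/-- Coloring pairs of residues by their difference up to sign is balanced, and a rainbow clique of
the right size would be a perfect difference set. -/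
theorem hasBalancedColoring_zmod {l q : ℕ} (hl : 0 < l) (hlq : 2 * l = q * q - q)
    (h : ¬ ∃ A : Finset (ZMod (2 * l + 1)), A.card = q ∧ IsPerfectDifferenceSet A) :
    HasBalancedColoring (ZMod (2 * l + 1)) l q := by
  have hle : ∀ x : ZMod (2 * l + 1), x.valMinAbs.natAbs ≤ l := fun x =>
    (ZMod.natAbs_valMinAbs_le x).trans (by omega)
  have hpos : ∀ x : ZMod (2 * l + 1), x ≠ 0 → 0 < x.valMinAbs.natAbs := fun x hx =>
    Int.natAbs_pos.2 (mt (ZMod.valMinAbs_eq_zero x).1 hx)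
  set c : ZMod (2 * l + 1) → ZMod (2 * l + 1) → Fin l :=
    fun a b => ⟨(a - b).valMinAbs.natAbs - 1, by have := hle (a - b); omega⟩ with hc
  have hceq : ∀ {a b a' b'}, a ≠ b → a' ≠ b' →
      (c a b = c a' b' ↔ a - b = a' - b' ∨ a - b = -(a' - b')) := by
    intro a b a' b' hab hab'
    have h₁ := hpos _ (sub_ne_zero.2 hab)
    have h₂ := hpos _ (sub_ne_zero.2 hab')
    rw [← ZMod.natAbs_valMinAbs_eq_natAbs_valMinAbs, hc, Fin.mk.injEq]
    omega
  refine ⟨c, fun a b => ?_, ⟨2, by rw [ZMod.card]; ring, fun v k => ?_⟩, ?_⟩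
  · simp only [hc, Fin.mk.injEq]
    rw [← neg_sub, ZMod.natAbs_valMinAbs_neg]
  · set z : ZMod (2 * l + 1) := ((k + 1 : ℕ) : ZMod (2 * l + 1)) with hz
    have hzval : z.valMinAbs.natAbs = k + 1 := by
      rw [hz, ZMod.valMinAbs_natCast_of_le_half (by omega), Int.natAbs_natCast]
    have hz0 : z ≠ 0 := by
      intro e
      rw [e] at hzval
      simp at hzval
    have hvz : v ≠ v - z := fun e => hz0 (by linear_combination e)
    have hck : c v (v - z) = k := by
      simp [hc, hzval]
    have hset : (Finset.univ.filter fun u => u ≠ v ∧ c v u = k) = {v - z, v + z} := by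
      ext u
      simp only [Finset.mem_filter, Finset.mem_univ, true_and, Finset.mem_insert,
        Finset.mem_singleton]
      constructor
      · rintro ⟨huv, hu⟩
        rw [← hck, hceq huv.symm hvz] at hu
        rcases hu with hu | hu
        · left; linear_combination -hu
        · right; linear_combination -hu
      · intro hu
        have huv : u ≠ v := by rcases hu with rfl | rfl <;> simpa using hz0
        refine ⟨huv, ?_⟩
        rw [← hck, hceq huv.symm hvz]
        rcases hu with rfl | rfl
        · exact Or.inl rfl
        · right; ring
    rw [hset, Finset.card_pair]
    intro e
    exact hz0 (ZMod.eq_zero_of_eq_neg_self (by linear_combination -e))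
  · rintro ⟨S, hS, hrain⟩
    refine h ⟨S, hS, isPerfectDifferenceSet_of_injOn (by rw [hS, hlq]) ?_⟩
    rintro ⟨a, b⟩ hab ⟨a', b'⟩ hab' (heq : a - b = a' - b')
    obtain ⟨ha, hb, hne⟩ := Finset.mem_offDiag.1 (Finset.mem_coe.1 hab)
    obtain ⟨ha', hb', hne'⟩ := Finset.mem_offDiag.1 (Finset.mem_coe.1 hab')
    rcases hrain a ha b hb a' ha' b' hb' hne hne' ((hceq hne hne').2 (Or.inl heq)) with e | e
    · exact Prod.ext e.1 e.2
    · refine absurd (ZMod.eq_zero_of_eq_neg_self ?_) (sub_ne_zero.2 hne)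
      rw [neg_sub, heq, e.1, e.2]

theorem no_pds_implies_balanced_colorings
    (q : ℕ) (hq : 2 ≤ q)
    (h : ¬ ∃ A : Finset (ZMod (q ^ 2 - q + 1)), A.card = q ∧ IsPerfectDifferenceSet A)
    (n₀ : ℕ) :
    ∃ n : ℕ, n₀ ≤ n ∧ n ≡ 1 [MOD q * (q - 1) / 2] ∧
      ∃ c : Fin n → Fin n → Fin (q * (q - 1) / 2),
        (∀ a b, c a b = c b a) ∧ IsCompletelyBalanced c ∧ ¬ HasRainbowClique c q := by
  obtain ⟨l, hl⟩ : ∃ l, q * (q - 1) = 2 * l := (Nat.even_mul_pred_self q).two_dvd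
  have hpos : 0 < l := by
    have : 0 < q * (q - 1) := Nat.mul_pos (by omega) (by omega)
    omega
  have hlq : 2 * l = q * q - q := by rw [← hl, Nat.mul_sub_one]
  have hdiv : q * (q - 1) / 2 = l := by omega
  rw [show q ^ 2 - q + 1 = 2 * l + 1 by rw [hlq, pow_two]] at h
  rw [hdiv]
  obtain ⟨c, hsymm, ⟨d, hcard, hd⟩, hr⟩ := (hasBalancedColoring_zmod hpos hlq h).pow n₀
  rw [Fintype.card_fin] at hcard
  refine ⟨_, ?_, ?_, c, hsymm, ⟨d, by omega, hd⟩, hr⟩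
  · rw [ZMod.card]
    exact (Nat.le_succ n₀).trans (Nat.lt_pow_self (by omega)).le
  · rw [hcard]
    simp [Nat.ModEq]
end
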